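/- arXiv:2405.00756 — 2 statements merged into one kernel-verified Lean document; each statement's English description precedes it below -/
import Mathlib

section
/- Let λ be a partition of n and T, T' ∈ RSSYT(λ) with T ↑ T'. Then the following element of the field ℚ(q,t) is nonzero: Σ_{τ} t^{c_τ(1)} · Π_{(□_1,□_2)∈Inv(τ)} (q^{T(□_1)}t^{c(□_1)+1} − q^{T(□_2)}t^{c(□_2)})/(q^{T(□_1)}t^{c(□_1)} − q^{T(□_2)}t^{c(□_2)}) · Π_{(□_1,□_2)∈Inv(Ψ(τ))} (q^{T'(□_1)}t^{c(□_1)} − q^{T'(□_2)}t^{c(□_2)})/(q^{T'(□_1)}t^{c(□_1)} − q^{T'(□_2)}t^{c(□_2)+1}), where the sum ranges over all τ ∈ PSYT(λ;T) with Ψ(τ) ∈ PSYT(λ;T'). (Up to an explicit nonzero factor this element is the e_1-Pieri coefficient d^{(1)}_{T',T}, so d^{(1)}_{T',T} ≠ 0.) -/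
open scoped Classical

/-- The content of a box `(i, j)` (row `i`, column `j`, both 0-indexed): `c(□) = j - i`. -/
def content (c : ℕ × ℕ) : ℤ := (c.2 : ℤ) - (c.1 : ℤ)

/-- The order on the formal labels `j·q^b` (encoded as pairs `(j, b)`):
`j·q^m < k·q^ℓ` iff `m > ℓ`, or `m = ℓ` and `j < k`. -/
def labelLT (x y : ℕ × ℕ) : Prop := y.2 < x.2 ∨ (x.2 = y.2 ∧ x.1 < y.1)

/-- `τ` is a (non-negative) periodic standard Young tableau on the finite cell set `s`
(a labelling of the boxes by symbols `j·q^b`, encoded as pairs `(j, b)`): each number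
`1 ≤ j ≤ s.card` occurs in exactly one box, the labels strictly increase along rows and
columns, and `τ` is normalized to `(0, 0)` off `s`. -/
def IsPSYT (s : Finset (ℕ × ℕ)) (τ : ℕ × ℕ → ℕ × ℕ) : Prop :=
  (∀ j, 1 ≤ j → j ≤ s.card → ∃! c, c ∈ s ∧ (τ c).1 = j) ∧
  (∀ c ∈ s, ∀ c' ∈ s, c.1 = c'.1 → c.2 + 1 = c'.2 → labelLT (τ c) (τ c')) ∧
  (∀ c ∈ s, ∀ c' ∈ s, c.1 + 1 = c'.1 → c.2 = c'.2 → labelLT (τ c) (τ c')) ∧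
  (∀ c, c ∉ s → τ c = (0, 0))

/-- `T` is a non-negative reverse Young tableau on `s`: entries weakly decrease along rows
and down columns (normalized to `0` off `s`). -/
def IsRYT (s : Finset (ℕ × ℕ)) (T : ℕ × ℕ → ℕ) : Prop :=
  (∀ c ∈ s, ∀ c' ∈ s, c.1 = c'.1 → c.2 + 1 = c'.2 → T c' ≤ T c) ∧
  (∀ c ∈ s, ∀ c' ∈ s, c.1 + 1 = c'.1 → c.2 = c'.2 → T c' ≤ T c) ∧
  (∀ c, c ∉ s → T c = 0)

/-- `T` is a non-negative reverse semi-standard Young tableau on `s`: entries weakly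
decrease along rows and strictly decrease down columns (normalized to `0` off `s`). -/
def IsRSSYT (s : Finset (ℕ × ℕ)) (T : ℕ × ℕ → ℕ) : Prop :=
  (∀ c ∈ s, ∀ c' ∈ s, c.1 = c'.1 → c.2 + 1 = c'.2 → T c' ≤ T c) ∧
  (∀ c ∈ s, ∀ c' ∈ s, c.1 + 1 = c'.1 → c.2 = c'.2 → T c' < T c) ∧
  (∀ c, c ∉ s → T c = 0)

/-- `τ ∈ PSYT(λ; T)`: a periodic standard Young tableau whose `q`-exponents are given
by `T`. -/
def InFiber (s : Finset (ℕ × ℕ)) (T : ℕ × ℕ → ℕ) (τ : ℕ × ℕ → ℕ × ℕ) : Prop :=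
  IsPSYT s τ ∧ ∀ c ∈ s, (τ c).2 = T c

/-- Column-standard reading order on boxes: columns left to right, each column top to
bottom. -/
def colReadLT (c c' : ℕ × ℕ) : Prop := c.2 < c'.2 ∨ (c.2 = c'.2 ∧ c.1 < c'.1)

/-- Row-standard reading order on boxes: rows top to bottom, left to right in each row. -/
def rowReadLT (c c' : ℕ × ℕ) : Prop := c.1 < c'.1 ∨ (c.1 = c'.1 ∧ c.2 < c'.2)

/-- The box order `□ <_T □'`: `T □ > T □'`, or `T □ = T □'` and `□` precedes `□'` in the
column-standard reading order. -/
def boxLT (T : ℕ × ℕ → ℕ) (c c' : ℕ × ℕ) : Prop :=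
  T c' < T c ∨ (T c = T c' ∧ colReadLT c c')

/-- The set `Inv(τ)` of inversion pairs of `τ` (with `q`-exponents `T`): ordered pairs of
boxes `(□₁, □₂)` with `□₁ <_T □₂` whose number labels are in decreasing order. -/
noncomputable def invSet (s : Finset (ℕ × ℕ)) (T : ℕ × ℕ → ℕ) (τ : ℕ × ℕ → ℕ × ℕ) :
    Finset ((ℕ × ℕ) × (ℕ × ℕ)) :=
  (s ×ˢ s).filter fun p => boxLT T p.1 p.2 ∧ (τ p.2).1 < (τ p.1).1

/-- `inv(τ) = |Inv(τ)|`. -/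
noncomputable def invNum (s : Finset (ℕ × ℕ)) (T : ℕ × ℕ → ℕ) (τ : ℕ × ℕ → ℕ × ℕ) : ℕ :=
  (invSet s T τ).card

/-- The auxiliary reading order used to define `Min(T)`: boxes with smaller `T`-value come
first, boxes of equal `T`-value in row-standard reading order. -/
def minOrd (T : ℕ × ℕ → ℕ) (c c' : ℕ × ℕ) : Prop :=
  T c < T c' ∨ (T c = T c' ∧ rowReadLT c c')

/-- The tableau `Min(T) ∈ PSYT(λ;T)`: `q`-exponents given by `T`, numbers `1, …, n`
assigned so that boxes with larger `T`-value receive larger numbers, boxes of equal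
`T`-value being numbered consecutively in row-standard reading order. -/
noncomputable def minTab (s : Finset (ℕ × ℕ)) (T : ℕ × ℕ → ℕ) : ℕ × ℕ → ℕ × ℕ :=
  fun c => if c ∈ s then ((s.filter fun c' => minOrd T c' c).card + 1, T c) else (0, 0)

/-- The labelling obtained from `T` by raising the value of the box `c0` by one. -/
def raiseAt (T : ℕ × ℕ → ℕ) (c0 : ℕ × ℕ) : ℕ × ℕ → ℕ :=
  fun c => if c = c0 then T c + 1 else T c

/-- The operation `Ψ`: each label `k·q^a` with `k ≥ 2` becomes `(k-1)·q^a`, and the label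
`1·q^a` becomes `n·q^(a+1)`. -/
def psiTab (s : Finset (ℕ × ℕ)) (τ : ℕ × ℕ → ℕ × ℕ) : ℕ × ℕ → ℕ × ℕ :=
  fun c => if c ∈ s then
    (if (τ c).1 = 1 then (s.card, (τ c).2 + 1) else ((τ c).1 - 1, (τ c).2))
  else (0, 0)

/-- The (unique) box of `s` carrying the number `j` in the tableau `τ`. -/
noncomputable def theBox (s : Finset (ℕ × ℕ)) (τ : ℕ × ℕ → ℕ × ℕ) (j : ℕ) : ℕ × ℕ :=
  if h : ∃ c, c ∈ s ∧ (τ c).1 = j then h.choose else (0, 0)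

/-- `c_τ(j)`: the content of the box whose label contains the number `j`. -/
noncomputable def cOf (s : Finset (ℕ × ℕ)) (τ : ℕ × ℕ → ℕ × ℕ) (j : ℕ) : ℤ :=
  content (theBox s τ j)

/-- The field `ℚ(q,t)` of rational functions in two variables over `ℚ`. -/
abbrev QQt : Type := FractionRing (MvPolynomial (Fin 2) ℚ)

/-- The element `q` of `ℚ(q,t)`. -/
noncomputable def qParam : QQt := algebraMap (MvPolynomial (Fin 2) ℚ) QQt (MvPolynomial.X 0)

/-- The element `t` of `ℚ(q,t)`. -/
noncomputable def tParam : QQt := algebraMap (MvPolynomial (Fin 2) ℚ) QQt (MvPolynomial.X 1)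

/-- Lagrange interpolation of `∏ (z - t x_a)` at the nodes `x_a`, evaluated at `0`. -/
theorem sum_prod_sub_mul_div_sub {K ι : Type*} [Field K] [Fintype ι] [DecidableEq ι] (t : K)
    (ht : t ≠ 1)
    (x : ι → K) (hx : Function.Injective x) (hx0 : ∀ i, x i ≠ 0) :
    ∑ b, ∏ a ∈ Finset.univ.erase b, (x b - t * x a) / (x b - x a)
      = ∑ i ∈ Finset.range (Fintype.card ι), t ^ i := by
  rcases isEmpty_or_nonempty ι with hι | hι
  · simp
  let P : Polynomial K := ∏ a, (Polynomial.X - Polynomial.C (t * x a))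
  let Q : Polynomial K := ∏ a, (Polynomial.X - Polynomial.C (x a))
  have hP : P.Monic := Polynomial.monic_prod_of_monic _ _ fun a _ => Polynomial.monic_X_sub_C _
  have hQ : Q.Monic := Polynomial.monic_prod_of_monic _ _ fun a _ => Polynomial.monic_X_sub_C _
  have hPd : P.degree = Fintype.card ι := by
    simp only [P, Polynomial.degree_prod, Polynomial.degree_X_sub_C]
    simp
  have hQd : Q.degree = Fintype.card ι := by simp [Q, Polynomial.degree_prod]
  have hd : (P - Q).degree < (Finset.univ : Finset ι).card := by
    rw [Finset.card_univ, ← hPd]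
    exact Polynomial.degree_sub_lt_left (hPd.trans hQd.symm) hP.ne_zero (hP.trans hQ.symm)
  have key := Lagrange.eq_interpolate_of_eval_eq (s := Finset.univ) (v := x) (f := P - Q)
    (fun b => P.eval (x b)) hx.injOn hd (by
      intro i _
      have : Q.eval (x i) = 0 := by
        simp only [Q, Polynomial.eval_prod]
        exact Finset.prod_eq_zero (Finset.mem_univ i) (by simp)
      simp [this])
  have key0 := congrArg (Polynomial.eval 0) key
  have hL : (P - Q).eval 0 = (t ^ Fintype.card ι - 1) * ∏ a, (-x a) := by
    simp only [P, Q, Polynomial.eval_sub, Polynomial.eval_prod, Polynomial.eval_X,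
      Polynomial.eval_C, zero_sub]
    rw [Finset.prod_congr rfl (fun a _ => (mul_neg t (x a)).symm), Finset.prod_mul_distrib,
      Finset.prod_const, Finset.card_univ]
    ring
  have hR : (Lagrange.interpolate Finset.univ x (fun b => P.eval (x b))).eval 0
      = (t - 1) * (∏ a, (-x a)) *
        ∑ b, ∏ a ∈ Finset.univ.erase b, (x b - t * x a) / (x b - x a) := by
    rw [Lagrange.interpolate_apply, Polynomial.eval_finsetSum, Finset.mul_sum]
    refine Finset.sum_congr rfl fun b _ => ?_
    simp only [P, Polynomial.eval_mul, Polynomial.eval_prod, Polynomial.eval_sub,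
      Polynomial.eval_X, Polynomial.eval_C, Lagrange.basis, Lagrange.basisDivisor, zero_sub]
    rw [← Finset.mul_prod_erase _ _ (Finset.mem_univ b),
      ← Finset.mul_prod_erase _ (fun a => -x a) (Finset.mem_univ b)]
    simp only [Finset.prod_mul_distrib, div_eq_mul_inv]
    ring
  rw [hL, hR] at key0
  have hne : ∏ a, (-x a) ≠ 0 := Finset.prod_ne_zero_iff.2 fun a _ => neg_ne_zero.2 (hx0 a)
  rw [geom_sum_eq ht, eq_div_iff (sub_ne_zero.2 ht)]
  apply mul_right_cancel₀ hne
  rw [key0]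
  ring

theorem sum_perm_prod_sub_mul_div_sub {K : Type*} [Field K] (t : K) (ht : t ≠ 1) (m : ℕ)
    (x : Fin m → K) (hx : Function.Injective x) (hx0 : ∀ i, x i ≠ 0) :
    ∑ w : Equiv.Perm (Fin m), ∏ a, ∏ b,
      (if a < b then (x (w a) - t * x (w b)) / (x (w a) - x (w b)) else 1)
      = ∏ k ∈ Finset.range m, ∑ i ∈ Finset.range (k + 1), t ^ i := by
  induction m with
  | zero => simp
  | succ m ih =>
    rw [← Equiv.Perm.decomposeFin.symm.sum_comp, Fintype.sum_prod_type, Finset.prod_range_succ,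
      mul_comm]
    have h := sum_prod_sub_mul_div_sub t ht x hx hx0
    rw [Fintype.card_fin] at h
    rw [← h, Finset.sum_mul]
    refine Finset.sum_congr rfl fun p _ => ?_
    let y : Fin m → Fin (m + 1) := fun i => Equiv.swap 0 p i.succ
    have hy : Function.Injective y := (Equiv.injective _).comp (Fin.succ_injective m)
    rw [← ih (x ∘ y) (hx.comp hy) (fun i => hx0 _), Finset.mul_sum]
    refine Finset.sum_congr rfl fun e _ => ?_
    rw [Fin.prod_univ_succ, Fin.prod_univ_succ]
    simp only [Fin.prod_univ_succ (n := m), lt_irrefl, if_false, one_mul, Fin.succ_pos, if_true,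
      Fin.succ_lt_succ_iff, Fin.not_lt_zero, Equiv.Perm.decomposeFin_symm_apply_succ,
      Equiv.Perm.decomposeFin_symm_apply_zero, Function.comp, y]
    congr 1
    rw [Equiv.prod_comp e (fun i => (x p - t * x (y i)) / (x p - x (y i)))]
    have hne : ∀ i, y i ≠ p := fun i h =>
      Fin.succ_ne_zero i ((Equiv.swap 0 p).injective (h.trans (Equiv.swap_apply_left 0 p).symm))
    have himage : Finset.univ.image y = Finset.univ.erase p := by
      refine Finset.eq_of_subset_of_card_le (fun a ha => ?_) ?_
      · obtain ⟨i, -, rfl⟩ := Finset.mem_image.1 ha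
        simp [hne i]
      · rw [Finset.card_image_of_injective _ hy]
        simp
    rw [← himage, Finset.prod_image hy.injOn]

/-- Hall–Littlewood symmetrization: summed over all numberings of a finite set, the product
over pairs in increasing order of `(x_a - t x_b) / (x_a - x_b)` is the `t`-factorial. -/
theorem sum_equiv_prod_sub_mul_div_sub {K B : Type*} [Field K] [Fintype B] [DecidableEq B] (t : K)
    (ht : t ≠ 1)
    (m : ℕ) (hm : Fintype.card B = m) (x : B → K) (hx : Function.Injective x)
    (hx0 : ∀ i, x i ≠ 0) :
    ∑ e : B ≃ Fin m, ∏ a, ∏ b, (if e a < e b then (x a - t * x b) / (x a - x b) else 1)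
      = ∏ k ∈ Finset.range m, ∑ i ∈ Finset.range (k + 1), t ^ i := by
  let β : Fin m ≃ B := (Fintype.equivFinOfCardEq hm).symm
  rw [← sum_perm_prod_sub_mul_div_sub t ht m (x ∘ β) (hx.comp β.injective) fun i => hx0 _]
  let Φ : Equiv.Perm (Fin m) ≃ (B ≃ Fin m) :=
    ⟨fun w => (w.trans β).symm, fun e => e.symm.trans β.symm,
      fun w => by ext; simp, fun e => by ext; simp⟩
  rw [← Φ.sum_comp]
  refine Finset.sum_congr rfl fun w _ => ?_
  rw [← (w.trans β).prod_comp]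
  refine Finset.prod_congr rfl fun a _ => ?_
  rw [← (w.trans β).prod_comp]
  refine Finset.prod_congr rfl fun b _ => ?_
  simp [Φ]

/-- Rewriting a product over inversions of a numbering `e` with respect to a total relation `R`
as a constant times a product over pairs in increasing order of `e`. -/
theorem prod_inversions_eq {K B : Type*} [Field K] [Fintype B] (t : K) {m : ℕ} (x : B → K)
    (hx : Function.Injective x) (R : B → B → Prop) (hasymm : ∀ a b, R a b → ¬ R b a)
    (htot : ∀ a b, a ≠ b → R a b ∨ R b a) (hR : ∀ a b, R a b → x a - t * x b ≠ 0)
    (e : B ≃ Fin m) :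
    ∏ a, ∏ b, (if R a b ∧ e b < e a then (t * x a - x b) / (x a - t * x b) else 1)
      = (∏ a, ∏ b, if R a b then (x a - x b) / (x a - t * x b) else 1) *
        ∏ a, ∏ b, (if e a < e b then (x a - t * x b) / (x a - x b) else 1) := by
  let k : B → B → K := fun a b => if e a < e b then (x a - t * x b) / (x a - x b) else 1
  have hk : ∏ a, ∏ b, k a b
      = (∏ a, ∏ b, if R a b then k a b else 1) * ∏ a, ∏ b, if R a b then k b a else 1 := by
    rw [Finset.prod_comm (f := fun a b => if R a b then k b a else 1)]
    simp only [← Finset.prod_mul_distrib]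
    refine Finset.prod_congr rfl fun a _ => Finset.prod_congr rfl fun b _ => ?_
    by_cases hab : a = b
    · subst hab
      simp [k]
    · rcases htot a b hab with h | h
      · simp [h, hasymm a b h]
      · simp [h, hasymm b a h]
  change _ = _ * ∏ a, ∏ b, k a b
  rw [hk]
  simp only [← Finset.prod_mul_distrib]
  refine Finset.prod_congr rfl fun a _ => Finset.prod_congr rfl fun b _ => ?_
  by_cases h : R a b
  · have hne : a ≠ b := fun h' => hasymm a b h (h' ▸ h' ▸ h)
    have h1 : x a - x b ≠ 0 := sub_ne_zero.2 (hx.ne hne)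
    have h2 : x b - x a ≠ 0 := sub_ne_zero.2 (hx.ne hne.symm)
    have h3 := hR a b h
    rcases lt_or_gt_of_ne (e.injective.ne hne) with h4 | h4
    · simp only [h, h4, k, if_true, true_and, not_lt_of_gt h4, if_false]
      have h3' : x a - x b * t ≠ 0 := by rwa [mul_comm (x b)]
      field_simp
    · simp only [h, h4, k, if_true, true_and, not_lt_of_gt h4, if_false]
      field_simp
      ring
  · simp [h]

theorem tParam_ne_zero : tParam ≠ 0 := by
  simp [tParam, MvPolynomial.X_ne_zero]

theorem qParam_ne_zero : qParam ≠ 0 := by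
  simp [qParam, MvPolynomial.X_ne_zero]

theorem qParam_pow_mul_tParam_zpow_inj {a b : ℕ} {c d : ℤ}
    (h : qParam ^ a * tParam ^ c = qParam ^ b * tParam ^ d) : a = b ∧ c = d := by
  obtain ⟨N, hc, hd⟩ : ∃ N : ℕ, 0 ≤ c + N ∧ 0 ≤ d + N := ⟨c.natAbs + d.natAbs, by omega, by omega⟩
  obtain ⟨c', hc'⟩ := Int.eq_ofNat_of_zero_le hc
  obtain ⟨d', hd'⟩ := Int.eq_ofNat_of_zero_le hd
  have h1 : qParam ^ a * tParam ^ c' = qParam ^ b * tParam ^ d' := by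
    rw [← zpow_natCast tParam c', ← zpow_natCast tParam d', ← hc', ← hd', zpow_add₀ tParam_ne_zero,
      zpow_add₀ tParam_ne_zero, ← mul_assoc, ← mul_assoc, h]
  have h2 : (MvPolynomial.X 0 ^ a * MvPolynomial.X 1 ^ c' : MvPolynomial (Fin 2) ℚ)
      = MvPolynomial.X 0 ^ b * MvPolynomial.X 1 ^ d' := by
    apply IsFractionRing.injective (MvPolynomial (Fin 2) ℚ) QQt
    simpa [qParam, tParam] using h1
  rw [MvPolynomial.X_pow_eq_monomial, MvPolynomial.X_pow_eq_monomial,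
    MvPolynomial.X_pow_eq_monomial, MvPolynomial.X_pow_eq_monomial, MvPolynomial.monomial_mul,
    MvPolynomial.monomial_mul] at h2
  have h3 := MvPolynomial.monomial_left_injective (R := ℚ) (by norm_num) h2
  have h4 := DFunLike.congr_fun h3 0
  have h5 := DFunLike.congr_fun h3 1
  simp at h4 h5
  omega

theorem sum_tParam_pow_ne_zero (k : ℕ) : ∑ i ∈ Finset.range (k + 1), tParam ^ i ≠ 0 := by
  intro h
  have h1 := geom_sum_mul tParam (k + 1)
  rw [h, zero_mul] at h1
  have h2 : qParam ^ 0 * tParam ^ ((k + 1 : ℕ) : ℤ) = qParam ^ 0 * tParam ^ (0 : ℤ) := by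
    rw [zpow_natCast, zpow_zero, sub_eq_zero.1 h1.symm]
  have := (qParam_pow_mul_tParam_zpow_inj h2).2
  omega

theorem tParam_ne_one : tParam ≠ 1 := by
  intro h
  have h2 : qParam ^ 0 * tParam ^ (1 : ℤ) = qParam ^ 0 * tParam ^ (0 : ℤ) := by simp [h]
  simpa using (qParam_pow_mul_tParam_zpow_inj h2).2

/-- The weight `q^{T □} t^{c □}` of a box. -/
noncomputable def boxWeight (T : ℕ × ℕ → ℕ) (c : ℕ × ℕ) : QQt :=
  qParam ^ T c * tParam ^ content c

theorem boxWeight_ne_zero (T : ℕ × ℕ → ℕ) (c : ℕ × ℕ) : boxWeight T c ≠ 0 :=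
  mul_ne_zero (pow_ne_zero _ qParam_ne_zero) (zpow_ne_zero _ tParam_ne_zero)

theorem qParam_pow_mul_tParam_zpow (T : ℕ × ℕ → ℕ) (c : ℕ × ℕ) :
    qParam ^ T c * tParam ^ content c = boxWeight T c := rfl

theorem qParam_pow_mul_tParam_zpow_add_one (T : ℕ × ℕ → ℕ) (c : ℕ × ℕ) :
    qParam ^ T c * tParam ^ (content c + 1) = tParam * boxWeight T c := by
  rw [boxWeight, zpow_add_one₀ tParam_ne_zero]
  ring

theorem eq_of_boxWeight_eq {T : ℕ × ℕ → ℕ} {c d : ℕ × ℕ} (h : boxWeight T c = boxWeight T d) :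
    T c = T d ∧ content c = content d :=
  qParam_pow_mul_tParam_zpow_inj h

theorem eq_of_boxWeight_eq_mul {T : ℕ × ℕ → ℕ} {c d : ℕ × ℕ}
    (h : boxWeight T c = tParam * boxWeight T d) : T c = T d ∧ content c = content d + 1 := by
  rw [← qParam_pow_mul_tParam_zpow_add_one] at h
  exact qParam_pow_mul_tParam_zpow_inj h

theorem colReadLT_or_of_ne {a b : ℕ × ℕ} (h : a ≠ b) : colReadLT a b ∨ colReadLT b a := by
  have : ¬(a.1 = b.1 ∧ a.2 = b.2) := fun h' => h (Prod.ext h'.1 h'.2)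
  unfold colReadLT
  omega

theorem boxLT_or_of_ne (T : ℕ × ℕ → ℕ) {a b : ℕ × ℕ} (h : a ≠ b) :
    boxLT T a b ∨ boxLT T b a := by
  have := colReadLT_or_of_ne h
  unfold boxLT
  rcases lt_trichotomy (T a) (T b) with h1 | h1 | h1
  · exact Or.inr (Or.inl h1)
  · exact this.imp (fun h => Or.inr ⟨h1, h⟩) fun h => Or.inr ⟨h1.symm, h⟩
  · exact Or.inl (Or.inl h1)

theorem boxLT_asymm {T : ℕ × ℕ → ℕ} {a b : ℕ × ℕ} (h : boxLT T a b) : ¬ boxLT T b a := by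
  unfold boxLT colReadLT at *
  omega

section HorizontalStrip

variable {μ : YoungDiagram} {T : ℕ × ℕ → ℕ}

theorem IsRSSYT.row_le (hT : IsRSSYT μ.cells T) {i j : ℕ} (k : ℕ) (h : (i, j + k) ∈ μ) :
    T (i, j + k) ≤ T (i, j) := by
  induction k with
  | zero => exact le_rfl
  | succ k ih =>
    have h1 : (i, j + k) ∈ μ := μ.up_left_mem le_rfl (by omega) h
    exact (hT.1 (i, j + k) h1 (i, j + (k + 1)) h rfl rfl).trans (ih h1)

theorem IsRSSYT.col_lt (hT : IsRSSYT μ.cells T) {i j : ℕ} (k : ℕ) (h : (i + (k + 1), j) ∈ μ) :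
    T (i + (k + 1), j) < T (i, j) := by
  induction k with
  | zero => exact hT.2.1 (i, j) (μ.up_left_mem (by omega) le_rfl h) (i + 1, j) h rfl rfl
  | succ k ih =>
    have h1 : (i + (k + 1), j) ∈ μ := μ.up_left_mem (by omega) le_rfl h
    exact (hT.2.1 (i + (k + 1), j) h1 (i + (k + 1 + 1), j) h rfl rfl).trans (ih h1)

/-- Each level set of a reverse semi-standard tableau is a horizontal strip. -/
theorem IsRSSYT.strip (hT : IsRSSYT μ.cells T) {a b : ℕ × ℕ} (ha : a ∈ μ.cells)
    (hb : b ∈ μ.cells) (hab : T a = T b) (h : colReadLT a b) : b.1 ≤ a.1 ∧ a.2 < b.2 := by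
  obtain ⟨i, j⟩ := a
  obtain ⟨i', j'⟩ := b
  have hb' : (i', j') ∈ μ := hb
  have hle : j ≤ j' := by
    simp only [colReadLT] at h
    omega
  have hi : i' ≤ i := by
    by_contra! hlt
    obtain ⟨k, rfl⟩ : ∃ k, i' = i + (k + 1) := ⟨i' - i - 1, by omega⟩
    obtain ⟨l, rfl⟩ := Nat.exists_eq_add_of_le hle
    have h1 := hT.row_le l hb'
    have h2 := hT.col_lt k (μ.up_left_mem le_rfl hle hb')
    omega
  simp only [colReadLT] at h
  exact ⟨hi, by omega⟩

theorem IsRSSYT.content_lt (hT : IsRSSYT μ.cells T) {a b : ℕ × ℕ} (ha : a ∈ μ.cells)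
    (hb : b ∈ μ.cells) (hab : T a = T b) (h : colReadLT a b) : content a < content b := by
  have := hT.strip ha hb hab h
  unfold content
  omega

theorem IsRSSYT.boxWeight_sub_ne_zero (hT : IsRSSYT μ.cells T) {a b : ℕ × ℕ} (ha : a ∈ μ.cells)
    (hb : b ∈ μ.cells) (hab : a ≠ b) : boxWeight T a - boxWeight T b ≠ 0 := by
  intro h
  obtain ⟨h1, h2⟩ := eq_of_boxWeight_eq (sub_eq_zero.1 h)
  rcases colReadLT_or_of_ne hab with h3 | h3
  · exact (hT.content_lt ha hb h1 h3).ne h2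
  · exact (hT.content_lt hb ha h1.symm h3).ne h2.symm

theorem IsRSSYT.boxWeight_sub_mul_ne_zero (hT : IsRSSYT μ.cells T) {a b : ℕ × ℕ}
    (ha : a ∈ μ.cells) (hb : b ∈ μ.cells) (hab : boxLT T a b) :
    boxWeight T a - tParam * boxWeight T b ≠ 0 := by
  intro h
  obtain ⟨h1, h2⟩ := eq_of_boxWeight_eq_mul (sub_eq_zero.1 h)
  have h3 : colReadLT a b := (hab.resolve_left (by omega)).2
  have := hT.content_lt ha hb h1 h3
  omega

/-- `t x_a - x_b` vanishes only for horizontally adjacent boxes of the same level. -/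
theorem IsRSSYT.adjacent_of_mul_boxWeight_sub (hT : IsRSSYT μ.cells T) {a b : ℕ × ℕ}
    (ha : a ∈ μ.cells) (hb : b ∈ μ.cells) (hab : boxLT T a b)
    (h : tParam * boxWeight T a - boxWeight T b = 0) :
    T a = T b ∧ a.1 = b.1 ∧ a.2 + 1 = b.2 := by
  obtain ⟨h1, h2⟩ := eq_of_boxWeight_eq_mul (sub_eq_zero.1 h).symm
  have h3 : colReadLT a b := (hab.resolve_left (by omega)).2
  have := hT.strip ha hb h1.symm h3
  unfold content at h2
  omega

end HorizontalStrip

theorem mul_boxWeight_sub_of_adjacent {T : ℕ × ℕ → ℕ} {a b : ℕ × ℕ} (hab : T a = T b)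
    (h1 : a.1 = b.1) (h2 : a.2 + 1 = b.2) : tParam * boxWeight T a - boxWeight T b = 0 := by
  have : content b = content a + 1 := by
    unfold content
    omega
  rw [← qParam_pow_mul_tParam_zpow_add_one, boxWeight, hab, this, sub_self]

theorem inFiber_of_injOn {s : Finset (ℕ × ℕ)} {T : ℕ × ℕ → ℕ} (hT : IsRSSYT s T)
    {τ : ℕ × ℕ → ℕ × ℕ} (hinj : Set.InjOn (fun c => (τ c).1) s)
    (hmem : ∀ c ∈ s, 1 ≤ (τ c).1 ∧ (τ c).1 ≤ s.card) (hexp : ∀ c ∈ s, (τ c).2 = T c)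
    (hoff : ∀ c, c ∉ s → τ c = (0, 0))
    (hrow : ∀ c ∈ s, ∀ c' ∈ s, c.1 = c'.1 → c.2 + 1 = c'.2 → T c = T c' →
      (τ c).1 < (τ c').1) : InFiber s T τ := by
  refine ⟨⟨fun j hj1 hj2 => ?_, fun c hc c' hc' h1 h2 => ?_, fun c hc c' hc' h1 h2 => ?_, hoff⟩,
    hexp⟩
  · have himage : s.image (fun c => (τ c).1) = Finset.Icc 1 s.card := by
      refine Finset.eq_of_subset_of_card_le (fun k hk => ?_) ?_
      · obtain ⟨c, hc, rfl⟩ := Finset.mem_image.1 hk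
        exact Finset.mem_Icc.2 (hmem c hc)
      · rw [Finset.card_image_of_injOn hinj]
        simp
    obtain ⟨c, hc, hcj⟩ := Finset.mem_image.1 (himage ▸ Finset.mem_Icc.2 ⟨hj1, hj2⟩)
    exact ⟨c, ⟨hc, hcj⟩, fun d hd => hinj hd.1 hc (hd.2.trans hcj.symm)⟩
  · have h3 := hT.1 c hc c' hc' h1 h2
    unfold labelLT
    rw [hexp c hc, hexp c' hc']
    rcases h3.lt_or_eq with h | h
    · exact Or.inl h
    · exact Or.inr ⟨h.symm, hrow c hc c' hc' h1 h2 h.symm⟩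
  · unfold labelLT
    rw [hexp c hc, hexp c' hc']
    exact Or.inl (hT.2.1 c hc c' hc' h1 h2)

theorem IsPSYT.injOn_and_mem {s : Finset (ℕ × ℕ)} {τ : ℕ × ℕ → ℕ × ℕ} (h : IsPSYT s τ) :
    Set.InjOn (fun c => (τ c).1) s ∧ ∀ c ∈ s, 1 ≤ (τ c).1 ∧ (τ c).1 ≤ s.card := by
  have hsub : Finset.Icc 1 s.card ⊆ s.image (fun c => (τ c).1) := by
    intro j hj
    obtain ⟨h1, h2⟩ := Finset.mem_Icc.1 hj
    obtain ⟨c, hc, -⟩ := h.1 j h1 h2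
    exact Finset.mem_image.2 ⟨c, hc⟩
  have himage := Finset.eq_of_subset_of_card_le hsub (by simpa using Finset.card_image_le)
  refine ⟨Finset.injOn_of_card_image_eq (by rw [← himage]; simp), fun c hc => ?_⟩
  exact Finset.mem_Icc.1 (himage ▸ Finset.mem_image_of_mem _ hc)

section Numbering

variable {s : Finset (ℕ × ℕ)} {T : ℕ × ℕ → ℕ} {c0 : ℕ × ℕ} {m : ℕ}

/-- The labelling with `q`-exponents `T` whose number at `c0` is `1`, the other boxes being
numbered by `e`. -/
noncomputable def ofNumbering (s : Finset (ℕ × ℕ)) (T : ℕ × ℕ → ℕ) (c0 : ℕ × ℕ)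
    (e : {c // c ∈ s.erase c0} ≃ Fin m) : ℕ × ℕ → ℕ × ℕ :=
  fun c => if h : c ∈ s.erase c0 then (e ⟨c, h⟩ + 2, T c) else
    if c = c0 then (1, T c0) else (0, 0)

variable (e : {c // c ∈ s.erase c0} ≃ Fin m)

theorem ofNumbering_self : ofNumbering s T c0 e c0 = (1, T c0) := by
  simp [ofNumbering]

theorem ofNumbering_coe (c : {c // c ∈ s.erase c0}) :
    ofNumbering s T c0 e c = ((e c : ℕ) + 2, T c) := by
  rw [ofNumbering, dif_pos c.2]

theorem ofNumbering_of_notMem (hc0 : c0 ∈ s) {c : ℕ × ℕ} (hc : c ∉ s) :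
    ofNumbering s T c0 e c = (0, 0) := by
  have : c ≠ c0 := fun h => hc (h ▸ hc0)
  simp [ofNumbering, hc, this]

theorem psiTab_ofNumbering_self (hc0 : c0 ∈ s) :
    psiTab s (ofNumbering s T c0 e) c0 = (s.card, T c0 + 1) := by
  simp [psiTab, hc0, ofNumbering_self]

theorem psiTab_ofNumbering_coe (c : {c // c ∈ s.erase c0}) :
    psiTab s (ofNumbering s T c0 e) c = ((e c : ℕ) + 1, T c) := by
  simp [psiTab, Finset.mem_of_mem_erase c.2, ofNumbering_coe]

theorem eq_or_exists_coe_of_mem {c : ℕ × ℕ} (hc : c ∈ s) :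
    c = c0 ∨ ∃ b : {c // c ∈ s.erase c0}, c = b := by
  by_cases h : c = c0
  · exact Or.inl h
  · exact Or.inr ⟨⟨c, Finset.mem_erase.2 ⟨h, hc⟩⟩, rfl⟩

theorem ofNumbering_injective :
    Function.Injective (ofNumbering s T c0 : ({c // c ∈ s.erase c0} ≃ Fin m) → _) := by
  intro e e' h
  ext c
  have := congrArg Prod.fst (congrFun h c)
  simp only [ofNumbering_coe] at this
  omega

theorem cOf_ofNumbering_one (hc0 : c0 ∈ s) :
    cOf s (ofNumbering s T c0 e) 1 = content c0 := by
  have hex : ∃ c, c ∈ s ∧ (ofNumbering s T c0 e c).1 = 1 := ⟨c0, hc0, by rw [ofNumbering_self]⟩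
  have hbox : theBox s (ofNumbering s T c0 e) 1 = c0 := by
    rw [theBox, dif_pos hex]
    rcases eq_or_exists_coe_of_mem (c0 := c0) hex.choose_spec.1 with h | ⟨b, hb⟩
    · exact h
    · have h1 := hex.choose_spec.2
      rw [hb, ofNumbering_coe] at h1
      simp at h1
  rw [cOf, hbox]

/-- The numbering increases along horizontally adjacent boxes of the same level. -/
def RowIncreasing (T : ℕ × ℕ → ℕ) (e : {c // c ∈ s.erase c0} ≃ Fin m) : Prop :=
  ∀ a b : {c // c ∈ s.erase c0}, a.1.1 = b.1.1 → a.1.2 + 1 = b.1.2 → T a = T b → e a < e b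

theorem raiseAt_self : raiseAt T c0 c0 = T c0 + 1 := by
  simp [raiseAt]

theorem raiseAt_coe (c : {c // c ∈ s.erase c0}) : raiseAt T c0 c = T c := by
  simp [raiseAt, Finset.ne_of_mem_erase c.2]

theorem inFiber_ofNumbering (hT : IsRSSYT s T) (hT' : IsRSSYT s (raiseAt T c0)) (hc0 : c0 ∈ s)
    (hm : s.card = m + 1) (he : RowIncreasing T e) : InFiber s T (ofNumbering s T c0 e) := by
  refine inFiber_of_injOn hT (fun a ha b hb hab => ?_) (fun c hc => ?_) (fun c hc => ?_)
    (fun c hc => ofNumbering_of_notMem e hc0 hc) (fun a ha b hb h1 h2 h3 => ?_)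
  · rcases eq_or_exists_coe_of_mem (c0 := c0) ha with h' | ⟨a, rfl⟩ <;>
    rcases eq_or_exists_coe_of_mem (c0 := c0) hb with h | ⟨b, rfl⟩
    · exact h'.trans h.symm
    · simp [h', ofNumbering_coe, ofNumbering_self] at hab
    · simp [h, ofNumbering_coe, ofNumbering_self] at hab
    · simp only [ofNumbering_coe, add_left_inj] at hab
      rw [e.injective (Fin.ext hab)]
  · rcases eq_or_exists_coe_of_mem (c0 := c0) hc with rfl | ⟨c, rfl⟩
    · simp [ofNumbering_self, hm]
    · simp only [ofNumbering_coe]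
      omega
  · rcases eq_or_exists_coe_of_mem (c0 := c0) hc with rfl | ⟨c, rfl⟩
    · simp [ofNumbering_self]
    · simp [ofNumbering_coe]
  · rcases eq_or_exists_coe_of_mem (c0 := c0) hb with rfl | ⟨b, rfl⟩
    · have h4 := hT'.1 a ha b hb h1 h2
      have hne : a ≠ b := by
        rintro rfl
        omega
      simp only [raiseAt, if_true, hne, if_false] at h4
      omega
    · rcases eq_or_exists_coe_of_mem (c0 := c0) ha with rfl | ⟨a, rfl⟩
      · simp [ofNumbering_coe, ofNumbering_self]
      · simpa [ofNumbering_coe] using he a b h1 h2 h3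

theorem inFiber_psiTab_ofNumbering (hT : IsRSSYT s T) (hT' : IsRSSYT s (raiseAt T c0))
    (hc0 : c0 ∈ s) (hm : s.card = m + 1) (he : RowIncreasing T e) :
    InFiber s (raiseAt T c0) (psiTab s (ofNumbering s T c0 e)) := by
  refine inFiber_of_injOn hT' (fun a ha b hb hab => ?_) (fun c hc => ?_) (fun c hc => ?_)
    (fun c hc => by simp [psiTab, hc]) (fun a ha b hb h1 h2 h3 => ?_)
  · rcases eq_or_exists_coe_of_mem (c0 := c0) ha with h' | ⟨a, rfl⟩ <;>
    rcases eq_or_exists_coe_of_mem (c0 := c0) hb with h | ⟨b, rfl⟩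
    · exact h'.trans h.symm
    · simp only [h', psiTab_ofNumbering_self e hc0, psiTab_ofNumbering_coe] at hab
      omega
    · simp only [h, psiTab_ofNumbering_self e hc0, psiTab_ofNumbering_coe] at hab
      omega
    · simp only [psiTab_ofNumbering_coe, add_left_inj] at hab
      rw [e.injective (Fin.ext hab)]
  · rcases eq_or_exists_coe_of_mem (c0 := c0) hc with rfl | ⟨c, rfl⟩
    · simp [psiTab_ofNumbering_self e hc0, hm]
    · simp only [psiTab_ofNumbering_coe]
      omega
  · rcases eq_or_exists_coe_of_mem (c0 := c0) hc with rfl | ⟨c, rfl⟩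
    · simp [psiTab_ofNumbering_self e hc0, raiseAt_self]
    · simp [psiTab_ofNumbering_coe, raiseAt_coe]
  · rcases eq_or_exists_coe_of_mem (c0 := c0) ha with rfl | ⟨a, rfl⟩
    · have h4 := hT.1 a ha b hb h1 h2
      have hne : b ≠ a := by
        rintro rfl
        omega
      simp only [raiseAt, if_true, hne, if_false] at h3
      omega
    · rcases eq_or_exists_coe_of_mem (c0 := c0) hb with rfl | ⟨b, rfl⟩
      · simp only [psiTab_ofNumbering_self e hc0, psiTab_ofNumbering_coe]
        omega
      · rw [raiseAt_coe, raiseAt_coe] at h3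
        simpa [psiTab_ofNumbering_coe] using he a b h1 h2 h3

theorem exists_ofNumbering_eq (hc0 : c0 ∈ s) (hm : s.card = m + 1) {τ : ℕ × ℕ → ℕ × ℕ}
    (hτ : InFiber s T τ) (hτ' : InFiber s (raiseAt T c0) (psiTab s τ)) :
    ∃ e : {c // c ∈ s.erase c0} ≃ Fin m, RowIncreasing T e ∧ ofNumbering s T c0 e = τ := by
  obtain ⟨hinj, hmem⟩ := hτ.1.injOn_and_mem
  have hone : (τ c0).1 = 1 := by
    by_contra h
    have h1 := hτ'.2 c0 hc0
    simp [psiTab, hc0, h, raiseAt_self, hτ.2 c0 hc0] at h1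
  have hge : ∀ c : {c // c ∈ s.erase c0}, 2 ≤ (τ c).1 := by
    intro c
    have h1 := (hmem c (Finset.mem_of_mem_erase c.2)).1
    have h2 : (τ c).1 ≠ (τ c0).1 := fun h =>
      Finset.ne_of_mem_erase c.2 (hinj (Finset.mem_of_mem_erase c.2) hc0 h)
    omega
  let f : {c // c ∈ s.erase c0} → Fin m := fun c =>
    ⟨(τ c).1 - 2, by
      have h1 := (hmem c (Finset.mem_of_mem_erase c.2)).2
      have h2 := hge c
      omega⟩
  have hf : Function.Injective f := by
    intro a b hab
    have h1 : (τ a).1 - 2 = (τ b).1 - 2 := congrArg Fin.val hab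
    have ha := hge a
    have hb := hge b
    exact Subtype.ext (hinj (Finset.mem_of_mem_erase a.2) (Finset.mem_of_mem_erase b.2)
      (show (τ a).1 = (τ b).1 by omega))
  have hbij : Function.Bijective f := by
    refine (Fintype.bijective_iff_injective_and_card f).2 ⟨hf, ?_⟩
    rw [Fintype.card_coe, Finset.card_erase_of_mem hc0, Fintype.card_fin, hm, Nat.add_sub_cancel]
  refine ⟨Equiv.ofBijective f hbij, fun a b h1 h2 h3 => ?_, funext fun c => ?_⟩
  · have ha := Finset.mem_of_mem_erase a.2
    have hb := Finset.mem_of_mem_erase b.2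
    have h4 := hτ.1.2.1 a ha b hb h1 h2
    have h5 := hge a
    unfold labelLT at h4
    rw [hτ.2 a ha, hτ.2 b hb] at h4
    change (τ a).1 - 2 < (τ b).1 - 2
    omega
  · by_cases hc : c ∈ s
    · rcases eq_or_exists_coe_of_mem (c0 := c0) hc with rfl | ⟨c, rfl⟩
      · rw [ofNumbering_self]
        exact Prod.ext hone.symm (hτ.2 c hc).symm
      · rw [ofNumbering_coe]
        refine Prod.ext ?_ (hτ.2 c hc).symm
        exact Nat.sub_add_cancel (hge c)
    · rw [ofNumbering_of_notMem _ hc0 hc, hτ.1.2.2.2 c hc]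

theorem fiber_eq_image (hT : IsRSSYT s T) (hT' : IsRSSYT s (raiseAt T c0)) (hc0 : c0 ∈ s)
    (hm : s.card = m + 1) :
    {τ | InFiber s T τ ∧ InFiber s (raiseAt T c0) (psiTab s τ)} =
      ↑(((Finset.univ : Finset ({c // c ∈ s.erase c0} ≃ Fin m)).filter (RowIncreasing T)).image
        (ofNumbering s T c0)) := by
  ext τ
  simp only [Set.mem_ofPred_eq, Finset.coe_image, Finset.coe_filter, Finset.mem_univ, true_and,
    Set.mem_image]
  constructor
  · rintro ⟨h, h'⟩
    exact exists_ofNumbering_eq hc0 hm h h'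
  · rintro ⟨e, he, rfl⟩
    exact ⟨inFiber_ofNumbering e hT hT' hc0 hm he, inFiber_psiTab_ofNumbering e hT hT' hc0 hm he⟩

theorem prod_invSet {M : Type*} [CommMonoid M] (hc0 : c0 ∈ s) (T : ℕ × ℕ → ℕ)
    (τ : ℕ × ℕ → ℕ × ℕ) (f : ℕ × ℕ → ℕ × ℕ → M) :
    ∏ p ∈ invSet s T τ, f p.1 p.2 =
      (∏ b : {c // c ∈ s.erase c0},
        if boxLT T c0 b ∧ (τ b).1 < (τ c0).1 then f c0 b else 1) *
      (∏ a : {c // c ∈ s.erase c0},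
        if boxLT T a c0 ∧ (τ c0).1 < (τ a).1 then f a c0 else 1) *
      ∏ a : {c // c ∈ s.erase c0}, ∏ b : {c // c ∈ s.erase c0},
        if boxLT T a b ∧ (τ b).1 < (τ a).1 then f a b else 1 := by
  have hsplit : ∀ h : ℕ × ℕ → M, ∏ c ∈ s, h c = h c0 * ∏ c : {c // c ∈ s.erase c0}, h c := by
    intro h
    rw [← Finset.mul_prod_erase s h hc0, Finset.prod_coe_sort (s.erase c0) h]
  rw [invSet, Finset.prod_filter, Finset.prod_product]
  simp only [hsplit]
  simp only [lt_irrefl, and_false, if_false, one_mul, Finset.prod_mul_distrib, mul_assoc]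

end Numbering

/-- Let `λ` be a partition of `n` and `T, T' ∈ RSSYT(λ)` with `T ↑ T'`
(differing at the box `□₀`). Then the sum, over all `τ ∈ PSYT(λ;T)` with
`Ψ(τ) ∈ PSYT(λ;T')`, of
`t^{c_τ(1)} · Π_{(□₁,□₂)∈Inv(τ)} (q^{T□₁}t^{c□₁+1} − q^{T□₂}t^{c□₂})/(q^{T□₁}t^{c□₁} − q^{T□₂}t^{c□₂})
· Π_{(□₁,□₂)∈Inv(Ψ(τ))} (q^{T'□₁}t^{c□₁} − q^{T'□₂}t^{c□₂})/(q^{T'□₁}t^{c□₁} − q^{T'□₂}t^{c□₂+1})`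
is a nonzero element of `ℚ(q,t)`. (Up to an explicit nonzero factor this is the
`e₁`-Pieri coefficient `d⁽¹⁾_{T',T}`, so `d⁽¹⁾_{T',T} ≠ 0`.) -/
theorem statement12 (μ : YoungDiagram) (n : ℕ) (hn : μ.card = n)
    (T T' : ℕ × ℕ → ℕ) (hT : IsRSSYT μ.cells T) (hT' : IsRSSYT μ.cells T')
    (c0 : ℕ × ℕ) (hc0 : c0 ∈ μ.cells) (hTT' : T' = raiseAt T c0) :
    (∑ᶠ τ ∈ {τ : ℕ × ℕ → ℕ × ℕ |
        InFiber μ.cells T τ ∧ InFiber μ.cells T' (psiTab μ.cells τ)},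
      tParam ^ cOf μ.cells τ 1 *
        (∏ p ∈ invSet μ.cells T τ,
          (qParam ^ T p.1 * tParam ^ (content p.1 + 1) -
              qParam ^ T p.2 * tParam ^ content p.2) /
            (qParam ^ T p.1 * tParam ^ content p.1 -
              qParam ^ T p.2 * tParam ^ content p.2)) *
        (∏ p ∈ invSet μ.cells T' (psiTab μ.cells τ),
          (qParam ^ T' p.1 * tParam ^ content p.1 -
              qParam ^ T' p.2 * tParam ^ content p.2) /
            (qParam ^ T' p.1 * tParam ^ content p.1 -
              qParam ^ T' p.2 * tParam ^ (content p.2 + 1)))) ≠ 0 := by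
  subst hTT'
  obtain ⟨m, hm⟩ : ∃ m, μ.cells.card = m + 1 :=
    Nat.exists_eq_succ_of_ne_zero (Finset.card_ne_zero_of_mem hc0)
  have hcard : Fintype.card {c // c ∈ μ.cells.erase c0} = m := by
    rw [Fintype.card_coe, Finset.card_erase_of_mem hc0, hm, Nat.add_sub_cancel]
  let R : {c // c ∈ μ.cells.erase c0} → {c // c ∈ μ.cells.erase c0} → Prop :=
    fun a b => boxLT T a b
  let x : {c // c ∈ μ.cells.erase c0} → QQt := fun a => boxWeight T a
  have hmem : ∀ a : {c // c ∈ μ.cells.erase c0}, a.1 ∈ μ.cells := fun a =>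
    Finset.mem_of_mem_erase a.2
  have hx : Function.Injective x := by
    intro a b hab
    by_contra hne
    exact hT.boxWeight_sub_ne_zero (hmem a) (hmem b) (fun h => hne (Subtype.ext h))
      (sub_eq_zero.2 hab)
  let D₁ : QQt := ∏ a : {c // c ∈ μ.cells.erase c0}, if boxLT T a c0 then
    (tParam * boxWeight T a - boxWeight T c0) / (boxWeight T a - boxWeight T c0) else 1
  let D₂ : QQt := ∏ b : {c // c ∈ μ.cells.erase c0}, if boxLT (raiseAt T c0) c0 b then
    (boxWeight (raiseAt T c0) c0 - boxWeight (raiseAt T c0) b) /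
      (boxWeight (raiseAt T c0) c0 - tParam * boxWeight (raiseAt T c0) b) else 1
  let W : ({c // c ∈ μ.cells.erase c0} ≃ Fin m) → QQt := fun e => ∏ a, ∏ b,
    if R a b ∧ e b < e a then (tParam * x a - x b) / (x a - tParam * x b) else 1
  have hD₁ : D₁ ≠ 0 := by
    refine Finset.prod_ne_zero_iff.2 fun a _ => ?_
    split_ifs with h
    · refine div_ne_zero (fun h0 => ?_)
        (hT.boxWeight_sub_ne_zero (hmem a) hc0 (Finset.ne_of_mem_erase a.2))
      obtain ⟨h1, h2, h3⟩ := hT.adjacent_of_mul_boxWeight_sub (hmem a) hc0 h h0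
      have h4 := hT'.1 a (hmem a) c0 hc0 h2 h3
      rw [raiseAt_self, raiseAt_coe] at h4
      omega
    · exact one_ne_zero
  have hD₂ : D₂ ≠ 0 := by
    refine Finset.prod_ne_zero_iff.2 fun b _ => ?_
    split_ifs with h
    · exact div_ne_zero
        (hT'.boxWeight_sub_ne_zero hc0 (hmem b) (Finset.ne_of_mem_erase b.2).symm)
        (hT'.boxWeight_sub_mul_ne_zero hc0 (hmem b) h)
    · exact one_ne_zero
  have hW : ∀ e, ¬ RowIncreasing T e → W e = 0 := by
    intro e he
    simp only [RowIncreasing, not_forall] at he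
    obtain ⟨a, b, h1, h2, h3, h4⟩ := he
    have hne : e b ≠ e a := e.injective.ne (by rintro rfl; omega)
    have hlt : e b < e a := lt_of_le_of_ne (not_lt.1 h4) hne
    have hab : R a b := Or.inr ⟨h3, Or.inl (by omega)⟩
    refine Finset.prod_eq_zero (Finset.mem_univ a) (Finset.prod_eq_zero (Finset.mem_univ b) ?_)
    rw [if_pos ⟨hab, hlt⟩]
    simp only [x]
    rw [mul_boxWeight_sub_of_adjacent h3 h1 h2, zero_div]
  rw [fiber_eq_image hT hT' hc0 hm, finsum_mem_coe_finset,
    Finset.sum_image ofNumbering_injective.injOn]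
  have hterm : ∀ e : {c // c ∈ μ.cells.erase c0} ≃ Fin m,
      tParam ^ cOf μ.cells (ofNumbering μ.cells T c0 e) 1 *
        (∏ p ∈ invSet μ.cells T (ofNumbering μ.cells T c0 e),
          (qParam ^ T p.1 * tParam ^ (content p.1 + 1) -
              qParam ^ T p.2 * tParam ^ content p.2) /
            (qParam ^ T p.1 * tParam ^ content p.1 -
              qParam ^ T p.2 * tParam ^ content p.2)) *
        (∏ p ∈ invSet μ.cells (raiseAt T c0) (psiTab μ.cells (ofNumbering μ.cells T c0 e)),
          (qParam ^ raiseAt T c0 p.1 * tParam ^ content p.1 -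
              qParam ^ raiseAt T c0 p.2 * tParam ^ content p.2) /
            (qParam ^ raiseAt T c0 p.1 * tParam ^ content p.1 -
              qParam ^ raiseAt T c0 p.2 * tParam ^ (content p.2 + 1)))
      = tParam ^ content c0 * D₁ * D₂ * W e := by
    intro e
    simp only [qParam_pow_mul_tParam_zpow_add_one, qParam_pow_mul_tParam_zpow]
    rw [cOf_ofNumbering_one e hc0,
      prod_invSet hc0 T _ fun a b =>
        (tParam * boxWeight T a - boxWeight T b) / (boxWeight T a - boxWeight T b),
      prod_invSet hc0 (raiseAt T c0) _ fun a b =>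
        (boxWeight (raiseAt T c0) a - boxWeight (raiseAt T c0) b) /
          (boxWeight (raiseAt T c0) a - tParam * boxWeight (raiseAt T c0) b)]
    have hw : ∀ a : {c // c ∈ μ.cells.erase c0}, boxWeight (raiseAt T c0) a = x a := by
      intro a
      simp only [boxWeight, raiseAt_coe, x]
    have hWe : W e =
        (∏ a : {c // c ∈ μ.cells.erase c0}, ∏ b : {c // c ∈ μ.cells.erase c0},
          if R a b ∧ e b < e a then (tParam * x a - x b) / (x a - x b) else 1) *
        ∏ a : {c // c ∈ μ.cells.erase c0}, ∏ b : {c // c ∈ μ.cells.erase c0},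
          if R a b ∧ e b < e a then (x a - x b) / (x a - tParam * x b) else 1 := by
      simp only [W, ← Finset.prod_mul_distrib]
      refine Finset.prod_congr rfl fun a _ => Finset.prod_congr rfl fun b _ => ?_
      split_ifs with h
      · have hne : x a - x b ≠ 0 := sub_ne_zero.2 (hx.ne fun h' => h.2.ne (h' ▸ rfl))
        rw [div_mul_div_cancel₀ hne]
      · simp
    have hRT : ∀ a b : {c // c ∈ μ.cells.erase c0}, boxLT (raiseAt T c0) a b ↔ R a b := by
      intro a b
      simp only [boxLT, raiseAt_coe, R]
    have hle : ∀ a : {c // c ∈ μ.cells.erase c0}, ¬ μ.cells.card < (e a : ℕ) + 1 := by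
      intro a
      omega
    have hlt : ∀ a : {c // c ∈ μ.cells.erase c0}, (e a : ℕ) + 1 < μ.cells.card := by
      intro a
      omega
    simp only [ofNumbering_self, ofNumbering_coe, psiTab_ofNumbering_self e hc0,
      psiTab_ofNumbering_coe, hRT, hle, hlt, and_true, and_false, if_false,
      Finset.prod_const_one, mul_one, add_lt_add_iff_right, Fin.val_fin_lt]
    rw [hWe]
    simp only [D₁, D₂, hw]
    have h1 : ∀ a : ℕ, ¬ a + 2 < 1 := by omega
    have h2 : ∀ a : ℕ, 1 < a + 2 := by omega
    simp only [h1, h2, and_true, and_false, if_false, Finset.prod_const_one, one_mul]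
    simp only [x, R]
    ring
  rw [Finset.sum_congr rfl fun e _ => hterm e, ← Finset.mul_sum, Finset.sum_filter_of_ne
    (fun e _ h => by_contra fun he => h (hW e he))]
  have hRne : ∀ a b, R a b → a ≠ b := fun a b h h' => boxLT_asymm h (h' ▸ h' ▸ h)
  have hden : ∀ a b, R a b → x a - tParam * x b ≠ 0 := fun a b h =>
    hT.boxWeight_sub_mul_ne_zero (hmem a) (hmem b) h
  have hWe := prod_inversions_eq tParam (m := m) x hx R (fun a b h => boxLT_asymm h)
    (fun a b h => boxLT_or_of_ne T fun h' => h (Subtype.ext h')) hden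
  simp only [W, hWe]
  rw [← Finset.mul_sum, sum_equiv_prod_sub_mul_div_sub tParam tParam_ne_one m hcard x hx
    fun a => boxWeight_ne_zero T a]
  refine mul_ne_zero (mul_ne_zero (mul_ne_zero (zpow_ne_zero _ tParam_ne_zero) hD₁) hD₂)
    (mul_ne_zero ?_ (Finset.prod_ne_zero_iff.2 fun k _ => sum_tParam_pow_ne_zero k))
  refine Finset.prod_ne_zero_iff.2 fun a _ => Finset.prod_ne_zero_iff.2 fun b _ => ?_
  split_ifs with h
  · exact div_ne_zero (sub_ne_zero.2 (hx.ne (hRne a b h))) (hden a b h)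
  · exact one_ne_zero
end

section
/- Let λ be a partition, T ∈ Ω(λ), and τ ∈ APSYT(λ;T). Then rk(τ) − rk(T) ≤ inv(τ) ≤ rk(τ)(rk(τ)−1)/2. -/
open scoped Classical

/-- Membership in the infinite diagram `λ^{(∞)}`: an infinite first row atop a copy of
the partition `λ` shifted down by one row. -/
def cellInf (μ : YoungDiagram) : ℕ × ℕ → Prop
  | (0, _) => True
  | (i + 1, j) => (i, j) ∈ μ

/-- Membership in the padded partition `λ^{(n)} = (n − |λ|, λ₁, …, λ_r)`. -/
def cellN (μ : YoungDiagram) (n : ℕ) : ℕ × ℕ → Prop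
  | (0, j) => j < n - μ.card
  | (i + 1, j) => (i, j) ∈ μ

/-- `n_λ := |λ| + λ₁`. -/
def nLam (μ : YoungDiagram) : ℕ := μ.card + μ.rowLen 0

/-- `T ∈ Ω(λ)`: a labelling of `λ^{(∞)}` by non-negative integers, with finitely many
nonzero values, weakly decreasing along rows and strictly decreasing down columns
(normalized to `0` off `λ^{(∞)}`). -/
def IsOmega (μ : YoungDiagram) (T : ℕ × ℕ → ℕ) : Prop :=
  (∀ c, ¬ cellInf μ c → T c = 0) ∧
  {c : ℕ × ℕ | T c ≠ 0}.Finite ∧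
  (∀ c : ℕ × ℕ, cellInf μ c → cellInf μ (c.1, c.2 + 1) → T (c.1, c.2 + 1) ≤ T c) ∧
  (∀ c : ℕ × ℕ, cellInf μ c → cellInf μ (c.1 + 1, c.2) → T (c.1 + 1, c.2) < T c)

/-- The degree `deg(T) = Σ_{□ ∈ λ^{(∞)}} T(□)`. -/
noncomputable def degOmega (T : ℕ × ℕ → ℕ) : ℕ := ∑ᶠ c, T c

/-- The rank `rk(T)`: the least `n ≥ n_λ` such that `T` vanishes on `λ^{(∞)} ∖ λ^{(n)}`. -/
noncomputable def rkOmega (μ : YoungDiagram) (T : ℕ × ℕ → ℕ) : ℕ :=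
  sInf {n | nLam μ ≤ n ∧ ∀ c, cellInf μ c → ¬ cellN μ n c → T c = 0}

/-- `τ ∈ APSYT(λ;T)`: a labelling of `λ^{(∞)}` by symbols `i·q^a` (encoded as pairs
`(i, a)`) in which every positive integer occurs exactly once, strictly increasing along
rows and columns, with only finitely many boxes carrying a positive power of `q`, and
whose `q`-exponents are given by `T` (normalized to `(0,0)` off `λ^{(∞)}`). -/
def IsAPSYT (μ : YoungDiagram) (T : ℕ × ℕ → ℕ) (τ : ℕ × ℕ → ℕ × ℕ) : Prop :=
  (∀ i : ℕ, 1 ≤ i → ∃! c, cellInf μ c ∧ (τ c).1 = i) ∧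
  (∀ c, cellInf μ c → 1 ≤ (τ c).1) ∧
  (∀ c : ℕ × ℕ, cellInf μ c → cellInf μ (c.1, c.2 + 1) → labelLT (τ c) (τ (c.1, c.2 + 1))) ∧
  (∀ c : ℕ × ℕ, cellInf μ c → cellInf μ (c.1 + 1, c.2) → labelLT (τ c) (τ (c.1 + 1, c.2))) ∧
  {c : ℕ × ℕ | cellInf μ c ∧ (τ c).2 ≠ 0}.Finite ∧
  (∀ c, cellInf μ c → (τ c).2 = T c) ∧
  (∀ c, ¬ cellInf μ c → τ c = (0, 0))

/-- The rank `rk(τ)`: the least `n ≥ n_λ` such that the boxes of `λ^{(∞)} ∖ λ^{(n)}`,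
read left to right, carry the consecutive labels `(n+1)·q⁰, (n+2)·q⁰, …`. -/
noncomputable def rkTab (μ : YoungDiagram) (τ : ℕ × ℕ → ℕ × ℕ) : ℕ :=
  sInf {n | nLam μ ≤ n ∧ ∀ k : ℕ, τ (0, n - μ.card + k) = (n + 1 + k, 0)}

/-- The set `Inv(τ)` of inversion pairs of `τ ∈ APSYT(λ;T)`. -/
def invSetInf (μ : YoungDiagram) (T : ℕ × ℕ → ℕ) (τ : ℕ × ℕ → ℕ × ℕ) :
    Set ((ℕ × ℕ) × (ℕ × ℕ)) :=
  {p | cellInf μ p.1 ∧ cellInf μ p.2 ∧ boxLT T p.1 p.2 ∧ (τ p.2).1 < (τ p.1).1}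

/-- `inv(τ) = |Inv(τ)|`. -/
noncomputable def invNumInf (μ : YoungDiagram) (T : ℕ × ℕ → ℕ) (τ : ℕ × ℕ → ℕ × ℕ) : ℕ :=
  (invSetInf μ T τ).ncard

lemma cellInf_zero (μ : YoungDiagram) (j : ℕ) : cellInf μ (0, j) := trivial

/-- A box outside `λ^{(n)}` lies in the first row, to the right of column `n - |λ|`. -/
lemma exists_of_not_cellN {μ : YoungDiagram} {n : ℕ} {c : ℕ × ℕ} (hc : cellInf μ c)
    (h : ¬ cellN μ n c) : ∃ k, c = (0, n - μ.card + k) := by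
  obtain ⟨_ | i, j⟩ := c
  · exact ⟨j - (n - μ.card), by simp only [cellN, not_lt] at h; simp; omega⟩
  · exact absurd hc h

lemma not_cellN_add (μ : YoungDiagram) (n k : ℕ) : ¬ cellN μ n (0, n - μ.card + k) := by
  simp [cellN]

lemma col_lt_of_cellN {μ : YoungDiagram} {n : ℕ} (hn : nLam μ ≤ n) {c : ℕ × ℕ}
    (h : cellN μ n c) : c.2 < n - μ.card := by
  obtain ⟨_ | i, j⟩ := c
  · exact h
  · have h1 : j < μ.rowLen i := YoungDiagram.mem_iff_lt_rowLen.1 h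
    have h2 : μ.rowLen i ≤ μ.rowLen 0 := μ.rowLen_anti 0 i (Nat.zero_le i)
    simp only [nLam] at hn
    simp only
    omega

/-- The boxes of `λ^{(j + |λ|)}`. -/
noncomputable def paddedCells (μ : YoungDiagram) (j : ℕ) : Finset (ℕ × ℕ) :=
  (Finset.range j).image (fun i => (0, i)) ∪ μ.cells.image (fun c => (c.1 + 1, c.2))

lemma zero_mem_paddedCells {μ : YoungDiagram} {j i : ℕ} :
    (0, i) ∈ paddedCells μ j ↔ i < j := by
  simp [paddedCells]

lemma succ_mem_paddedCells {μ : YoungDiagram} {j r i : ℕ} :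
    (r + 1, i) ∈ paddedCells μ j ↔ cellInf μ (r + 1, i) := by
  simp [paddedCells, cellInf]

lemma card_paddedCells (μ : YoungDiagram) (j : ℕ) :
    (paddedCells μ j).card = j + μ.card := by
  rw [paddedCells, Finset.card_union_of_disjoint, Finset.card_image_of_injective,
    Finset.card_image_of_injective, Finset.card_range]
  · intro a b h
    simpa [Prod.ext_iff] using h
  · intro a b h
    simpa using h
  · rw [Finset.disjoint_left]
    simp only [Finset.mem_image, not_exists, not_and]
    rintro _ ⟨i, _, rfl⟩ c _ h
    simp at h

lemma cellInf_of_mem_paddedCells {μ : YoungDiagram} {j : ℕ} {c : ℕ × ℕ}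
    (h : c ∈ paddedCells μ j) : cellInf μ c := by
  obtain ⟨_ | r, i⟩ := c
  · trivial
  · exact succ_mem_paddedCells.1 h

lemma IsOmega.exists_row_zero {μ : YoungDiagram} {T : ℕ × ℕ → ℕ} (hT : IsOmega μ T) :
    ∃ J, ∀ j, J ≤ j → T (0, j) = 0 := by
  obtain ⟨B, hB⟩ := (hT.2.1.image Prod.snd).bddAbove
  refine ⟨B + 1, fun j hj => ?_⟩
  by_contra h
  have : j ≤ B := hB ⟨(0, j), h, rfl⟩
  omega

section APSYT

variable {μ : YoungDiagram} {T : ℕ × ℕ → ℕ} {τ : ℕ × ℕ → ℕ × ℕ}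

lemma IsAPSYT.label_injective (hτ : IsAPSYT μ T τ) {c d : ℕ × ℕ} (hc : cellInf μ c)
    (hd : cellInf μ d) (h : (τ c).1 = (τ d).1) : c = d :=
  (hτ.1 _ (hτ.2.1 c hc)).unique ⟨hc, rfl⟩ ⟨hd, h.symm⟩

lemma IsAPSYT.label_lt_label (hτ : IsAPSYT μ T τ) {J : ℕ} (hJ : ∀ j, J ≤ j → T (0, j) = 0)
    {i j : ℕ} (hi : J ≤ i) (hij : i < j) : (τ (0, i)).1 < (τ (0, j)).1 := by
  have step : ∀ m, J ≤ m → (τ (0, m)).1 < (τ (0, m + 1)).1 := by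
    intro m hm
    have hT (a : ℕ) (ha : J ≤ a) : (τ (0, a)).2 = 0 := by
      rw [hτ.2.2.2.2.2.1 _ (cellInf_zero μ a), hJ a ha]
    rcases hτ.2.2.1 (0, m) (cellInf_zero μ m) (cellInf_zero μ (m + 1)) with h | h
    · rw [hT m hm] at h
      exact absurd h (Nat.not_lt_zero _)
    · exact h.2
  induction j, hij using Nat.le_induction with
  | base => exact step i hi
  | succ m hm ih => exact ih.trans (step m (by omega))

/-- The rank of `τ` is attained: the set defining `rkTab` is nonempty. -/
lemma IsAPSYT.exists_rank (hT : IsOmega μ T) (hτ : IsAPSYT μ T τ) :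
    ∃ n, nLam μ ≤ n ∧ ∀ k : ℕ, τ (0, n - μ.card + k) = (n + 1 + k, 0) := by
  obtain ⟨J, hJ⟩ := hT.exists_row_zero
  obtain ⟨M, hM⟩ := ((paddedCells μ J).image fun c => (τ c).1).bddAbove
  have hlt {i j : ℕ} (hi : J ≤ i) (hij : i < j) := hτ.label_lt_label hJ hi hij
  have hgrow : ∀ k, k ≤ (τ (0, J + k)).1 := by
    intro k
    induction k with
    | zero => exact Nat.zero_le _
    | succ k ih =>
      have := hlt (i := J + k) (j := J + (k + 1)) (by omega) (by omega)
      omega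
  have hlabel : ∀ j, J + M + 1 ≤ j → (τ (0, j)).1 = j + μ.card + 1 := by
    intro j hj
    have hbig : M < (τ (0, j)).1 := by
      have := hgrow (j - J)
      rw [show J + (j - J) = j by omega] at this
      omega
    have himage : (paddedCells μ j).image (fun c => (τ c).1) =
        Finset.Ico 1 (τ (0, j)).1 := by
      ext a
      simp only [Finset.mem_image, Finset.mem_Ico]
      constructor
      · rintro ⟨c, hc, rfl⟩
        refine ⟨hτ.2.1 c (cellInf_of_mem_paddedCells hc), ?_⟩
        by_cases hcJ : c ∈ paddedCells μ J
        · have : (τ c).1 ≤ M := hM (by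
            simpa using ⟨c.1, c.2, hcJ, rfl⟩)
          omega
        · obtain ⟨_ | r, i⟩ := c
          · rw [zero_mem_paddedCells] at hc hcJ
            exact hlt (by omega) hc
          · exact absurd (succ_mem_paddedCells.2 (succ_mem_paddedCells.1 hc)) hcJ
      · rintro ⟨h1, h2⟩
        obtain ⟨c, ⟨hc, rfl⟩, -⟩ := hτ.1 a h1
        refine ⟨c, ?_, rfl⟩
        obtain ⟨_ | r, i⟩ := c
        · rw [zero_mem_paddedCells]
          by_contra! h
          rcases h.eq_or_lt with rfl | h
          · omega
          · have := hlt (by omega) h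
            omega
        · exact succ_mem_paddedCells.2 hc
    have hcard := congrArg Finset.card himage
    rw [Finset.card_image_of_injOn (fun c hc d hd h => hτ.label_injective
      (cellInf_of_mem_paddedCells hc) (cellInf_of_mem_paddedCells hd) h),
      card_paddedCells, Nat.card_Ico] at hcard
    omega
  refine ⟨J + M + 1 + μ.rowLen 0 + μ.card, by simp only [nLam]; omega, fun k => ?_⟩
  rw [Nat.add_sub_cancel]
  refine Prod.ext ?_ ?_
  · rw [hlabel _ (by omega)]
    simp only
    omega
  · rw [hτ.2.2.2.2.2.1 _ (cellInf_zero μ _), hJ _ (by omega)]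

lemma IsAPSYT.rkTab_spec (hT : IsOmega μ T) (hτ : IsAPSYT μ T τ) :
    nLam μ ≤ rkTab μ τ ∧
      ∀ k : ℕ, τ (0, rkTab μ τ - μ.card + k) = (rkTab μ τ + 1 + k, 0) :=
  Nat.sInf_mem (s := {n | nLam μ ≤ n ∧ ∀ k : ℕ, τ (0, n - μ.card + k) = (n + 1 + k, 0)})
    (hτ.exists_rank hT)

lemma IsAPSYT.label_le_iff_cellN (hτ : IsAPSYT μ T τ) {n : ℕ}
    (hn : ∀ k : ℕ, τ (0, n - μ.card + k) = (n + 1 + k, 0)) {c : ℕ × ℕ}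
    (hc : cellInf μ c) : (τ c).1 ≤ n ↔ cellN μ n c := by
  constructor
  · intro h
    by_contra hcn
    obtain ⟨k, rfl⟩ := exists_of_not_cellN hc hcn
    rw [hn k] at h
    simp only at h
    omega
  · intro hcn
    by_contra! h
    refine not_cellN_add μ n ((τ c).1 - (n + 1)) ?_
    rwa [← hτ.label_injective hc (cellInf_zero μ (n - μ.card + ((τ c).1 - (n + 1))))
      (by rw [hn]; simp only; omega)]

lemma IsAPSYT.rkOmega_spec (hτ : IsAPSYT μ T τ) (hT : IsOmega μ T) :
    nLam μ ≤ rkOmega μ T ∧ ∀ c, cellInf μ c → ¬ cellN μ (rkOmega μ T) c → T c = 0 := by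
  refine Nat.sInf_mem (s := {n | nLam μ ≤ n ∧ ∀ c, cellInf μ c → ¬ cellN μ n c → T c = 0})
    ⟨rkTab μ τ, (hτ.rkTab_spec hT).1, fun c hc hcn => ?_⟩
  obtain ⟨k, rfl⟩ := exists_of_not_cellN hc hcn
  rw [← hτ.2.2.2.2.2.1 _ hc, (hτ.rkTab_spec hT).2 k]

/-- The larger label of an inversion is at most `rk τ`. -/
lemma IsAPSYT.label_le_rkTab_of_inversion (hT : IsOmega μ T) (hτ : IsAPSYT μ T τ)
    {c d : ℕ × ℕ} (hc : cellInf μ c) (hd : cellInf μ d) (hlt : boxLT T c d)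
    (hlabel : (τ d).1 < (τ c).1) : (τ c).1 ≤ rkTab μ τ := by
  obtain ⟨hn, hrk⟩ := hτ.rkTab_spec hT
  rw [hτ.label_le_iff_cellN hrk hc]
  by_contra hcn
  obtain ⟨k, rfl⟩ := exists_of_not_cellN hc hcn
  have hTc : T (0, rkTab μ τ - μ.card + k) = 0 := by
    rw [← hτ.2.2.2.2.2.1 _ hc, hrk k]
  have hcol : colReadLT (0, rkTab μ τ - μ.card + k) d := by
    rcases hlt with h | h
    · omega
    · exact h.2
  have hdn : ¬ cellN μ (rkTab μ τ) d := by
    intro h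
    have := col_lt_of_cellN hn h
    rcases hcol with h | h <;> simp only at h <;> omega
  obtain ⟨l, rfl⟩ := exists_of_not_cellN hd hdn
  rw [hrk, hrk] at hlabel
  simp only [colReadLT] at hcol hlabel
  omega

/-- An inversion is determined by its pair of labels, which lies in `{1, …, rk τ}`. -/
lemma IsAPSYT.mapsTo_injOn_labelPair (hT : IsOmega μ T) (hτ : IsAPSYT μ T τ) :
    Set.MapsTo (fun p : (ℕ × ℕ) × (ℕ × ℕ) => ({(τ p.1).1, (τ p.2).1} : Finset ℕ))
      (invSetInf μ T τ) (Finset.powersetCard 2 (Finset.Icc 1 (rkTab μ τ))) ∧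
    Set.InjOn (fun p : (ℕ × ℕ) × (ℕ × ℕ) => ({(τ p.1).1, (τ p.2).1} : Finset ℕ))
      (invSetInf μ T τ) := by
  constructor
  · rintro ⟨c, d⟩ ⟨hc, hd, hlt, hlabel⟩
    have hle := hτ.label_le_rkTab_of_inversion hT hc hd hlt hlabel
    have hc1 := hτ.2.1 c hc
    have hd1 := hτ.2.1 d hd
    simp only at hlabel hle hc1 hd1
    simp only [Finset.mem_coe, Finset.mem_powersetCard, Finset.insert_subset_iff,
      Finset.singleton_subset_iff, Finset.mem_Icc]
    exact ⟨⟨⟨hc1, hle⟩, hd1, by omega⟩, Finset.card_pair hlabel.ne'⟩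
  · rintro ⟨c, d⟩ ⟨hc, hd, -, hcd⟩ ⟨c', d'⟩ ⟨hc', hd', -, hcd'⟩ h
    simp only at hcd hcd' hc hd hc' hd' h
    have h1 : (τ c).1 = (τ c').1 ∧ (τ d).1 = (τ d').1 := by
      have e1 : (τ c).1 ∈ ({(τ c').1, (τ d').1} : Finset ℕ) := by rw [← h]; simp
      have e2 : (τ d).1 ∈ ({(τ c').1, (τ d').1} : Finset ℕ) := by rw [← h]; simp
      simp only [Finset.mem_insert, Finset.mem_singleton] at e1 e2
      omega
    rw [hτ.label_injective hc hc' h1.1, hτ.label_injective hd hd' h1.2]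

lemma IsAPSYT.finite_invSetInf (hT : IsOmega μ T) (hτ : IsAPSYT μ T τ) :
    (invSetInf μ T τ).Finite :=
  Set.Finite.of_injOn (hτ.mapsTo_injOn_labelPair hT).1 (hτ.mapsTo_injOn_labelPair hT).2
    (Finset.finite_toSet _)

lemma IsAPSYT.invNumInf_le (hT : IsOmega μ T) (hτ : IsAPSYT μ T τ) :
    invNumInf μ T τ ≤ (rkTab μ τ).choose 2 := by
  have h := Set.ncard_le_ncard_of_injOn _ (hτ.mapsTo_injOn_labelPair hT).1
    (hτ.mapsTo_injOn_labelPair hT).2 (Finset.finite_toSet _)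
  rwa [Set.ncard_coe_finset, Finset.card_powersetCard, Nat.card_Icc,
    Nat.add_sub_cancel] at h

/-- If `rk T < rk τ`, then the label `rk τ` sits in a box of `λ^{(rk T)}`. -/
lemma IsAPSYT.exists_label_eq_rkTab (hT : IsOmega μ T) (hτ : IsAPSYT μ T τ)
    (h : rkOmega μ T < rkTab μ τ) :
    ∃ b, cellInf μ b ∧ cellN μ (rkOmega μ T) b ∧ (τ b).1 = rkTab μ τ := by
  obtain ⟨hn, hrk⟩ := hτ.rkTab_spec hT
  obtain ⟨hnT, hrkT⟩ := hτ.rkOmega_spec hT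
  obtain ⟨b, ⟨hb, hbl⟩, -⟩ := hτ.1 (rkTab μ τ) (by omega)
  refine ⟨b, hb, ?_, hbl⟩
  by_contra hbn
  obtain ⟨k, rfl⟩ := exists_of_not_cellN hb hbn
  have hJ : ∀ j, rkOmega μ T - μ.card ≤ j → T (0, j) = 0 := fun j hj =>
    hrkT _ (cellInf_zero μ j) (by simpa [cellN] using hj)
  have hcard : μ.card ≤ rkOmega μ T := le_trans (Nat.le_add_right _ _) hnT
  have hin : rkOmega μ T - μ.card + k < rkTab μ τ - μ.card :=
    (hτ.label_le_iff_cellN hrk hb).1 hbl.le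
  have hlast : rkOmega μ T - μ.card + k = rkTab μ τ - 1 - μ.card := by
    by_contra hne
    have h1 := hτ.label_lt_label hJ (i := rkOmega μ T - μ.card + k)
      (j := rkTab μ τ - 1 - μ.card) (by omega) (by omega)
    have h2 : (τ (0, rkTab μ τ - 1 - μ.card)).1 ≤ rkTab μ τ :=
      (hτ.label_le_iff_cellN hrk (cellInf_zero μ _)).2
        (show rkTab μ τ - 1 - μ.card < rkTab μ τ - μ.card by omega)
    omega
  rw [hlast] at hbl
  have hmem : rkTab μ τ - 1 ∈
      {n | nLam μ ≤ n ∧ ∀ k : ℕ, τ (0, n - μ.card + k) = (n + 1 + k, 0)} := by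
    refine ⟨by omega, fun l => ?_⟩
    rcases l with _ | l
    · refine Prod.ext ?_ ?_
      · rw [Nat.add_zero, hbl]
        simp only
        omega
      · rw [hτ.2.2.2.2.2.1 _ (cellInf_zero μ _), hJ _ (by omega)]
    · rw [show rkTab μ τ - 1 - μ.card + (l + 1) = rkTab μ τ - μ.card + l by omega, hrk l,
        show rkTab μ τ - 1 + 1 + (l + 1) = rkTab μ τ + 1 + l by omega]
  have : rkTab μ τ ≤ rkTab μ τ - 1 := Nat.sInf_le hmem
  omega

lemma IsAPSYT.rkTab_sub_rkOmega_le (hT : IsOmega μ T) (hτ : IsAPSYT μ T τ) :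
    rkTab μ τ - rkOmega μ T ≤ invNumInf μ T τ := by
  rcases le_or_gt (rkTab μ τ) (rkOmega μ T) with h | h
  · omega
  obtain ⟨hn, hrk⟩ := hτ.rkTab_spec hT
  obtain ⟨hnT, hrkT⟩ := hτ.rkOmega_spec hT
  obtain ⟨b, hb, hbn, hbl⟩ := hτ.exists_label_eq_rkTab hT h
  have hcard : μ.card ≤ rkOmega μ T := le_trans (Nat.le_add_right _ _) hnT
  have hle := Set.ncard_le_ncard_of_injOn (s := (Finset.range (rkTab μ τ - rkOmega μ T) : Set ℕ))
    (t := invSetInf μ T τ) (fun k => (b, (0, rkOmega μ T - μ.card + k))) ?_ ?_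
    (hτ.finite_invSetInf hT)
  · rwa [Set.ncard_coe_finset, Finset.card_range] at hle
  · intro k hk
    simp only [Finset.coe_range, Set.mem_Iio] at hk
    have hout := not_cellN_add μ (rkOmega μ T) k
    have hTk := hrkT _ (cellInf_zero μ _) hout
    refine ⟨hb, cellInf_zero μ _, ?_, ?_⟩
    · rcases Nat.eq_zero_or_pos (T b) with h0 | h0
      · have := col_lt_of_cellN hnT hbn
        exact Or.inr ⟨h0.trans hTk.symm, Or.inl (by simp only; omega)⟩
      · exact Or.inl (hTk.trans_lt h0)
    · have hne : (τ (0, rkOmega μ T - μ.card + k)).1 ≠ (τ b).1 := fun he =>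
        hout (hτ.label_injective (cellInf_zero μ _) hb he ▸ hbn)
      have hle : (τ (0, rkOmega μ T - μ.card + k)).1 ≤ rkTab μ τ :=
        (hτ.label_le_iff_cellN hrk (cellInf_zero μ _)).2
          (show rkOmega μ T - μ.card + k < rkTab μ τ - μ.card by omega)
      simp only
      omega
  · intro k _ l _ hkl
    simpa using hkl

end APSYT

/-- Let `λ` be a partition, `T ∈ Ω(λ)`, and `τ ∈ APSYT(λ;T)`. Then
`rk(τ) − rk(T) ≤ inv(τ) ≤ rk(τ)(rk(τ)−1)/2`. -/
theorem statement14 (μ : YoungDiagram) (T : ℕ × ℕ → ℕ) (hT : IsOmega μ T)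
    (τ : ℕ × ℕ → ℕ × ℕ) (hτ : IsAPSYT μ T τ) :
    rkTab μ τ - rkOmega μ T ≤ invNumInf μ T τ ∧
    invNumInf μ T τ ≤ (rkTab μ τ).choose 2 := by
  exact ⟨hτ.rkTab_sub_rkOmega_le hT, hτ.invNumInf_le hT⟩
end
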